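/- For no integer n ≥ 4 with n ≡ 4 (mod 6) do there exist permutations σ₁, σ₂, σ₃ of {1,…,n} with σ₁σ₂σ₃ = 1, generating a subgroup that acts transitively on {1,…,n}, such that the full cycle type of σ₁ consists of n/2 copies of 2, the full cycle type of σ₂ consists of one 1 and (n−1)/3 copies of 3, and the full cycle type of σ₃ consists of two 2's and (n−4)/6 copies of 6. (That is, the genus-0 ramification type [2^*][1,3^*][2,2,6^*] is not realizable in any degree.) -/

import Mathlib

/-- The full cycle type of a permutation of a finite set: the multiset of the lengths of its
cycles, where each fixed point counts as a cycle of length 1. -/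
def fullCycleType {α : Type*} [Fintype α] [DecidableEq α] (σ : Equiv.Perm α) : Multiset ℕ :=
  σ.cycleType + Multiset.replicate (Fintype.card α - σ.cycleType.sum) 1

/-- The subgroup generated by a set of permutations acts transitively. -/
def IsTransitiveSet {α : Type*} (s : Set (Equiv.Perm α)) : Prop :=
  ∀ x y : α, ∃ g ∈ Subgroup.closure s, g x = y

/-- A ramification data, given as a list of multisets of positive integers (partitions of `n`),
is realizable if there are permutations of `{1,…,n}` with product 1, generating a transitive
subgroup, whose full cycle types are the given multisets. -/
def Realizable (n : ℕ) (E : List (Multiset ℕ)) : Prop :=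
  ∃ σ : List (Equiv.Perm (Fin n)),
    σ.map fullCycleType = E ∧ σ.prod = 1 ∧ IsTransitiveSet {g | g ∈ σ}

open Equiv Function

section CycleType

variable {α : Type*} [Fintype α] [DecidableEq α]

theorem count_one_fullCycleType (σ : Perm α) :
    (fullCycleType σ).count 1 = Fintype.card (fixedPoints σ) := by
  have h : σ.cycleType.count 1 = 0 :=
    Multiset.count_eq_zero.mpr fun h => absurd (Perm.two_le_of_mem_cycleType h) (by norm_num)
  rw [fullCycleType, Multiset.count_add, h, Multiset.count_replicate_self, zero_add,
    Perm.card_fixedPoints]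

theorem pow_eq_one_of_forall_mem_fullCycleType {σ : Perm α} {k : ℕ}
    (h : ∀ m ∈ fullCycleType σ, m ∣ k) : σ ^ k = 1 := by
  rw [← orderOf_dvd_iff_pow_eq_one, ← Perm.lcm_cycleType, Multiset.lcm_dvd]
  exact fun m hm => h m (Multiset.mem_add.mpr (Or.inl hm))

theorem exists_mem_fullCycleType_dvd {σ : Perm α} {k : ℕ} {x : α} (h : (σ ^ k) x = x) :
    ∃ m ∈ fullCycleType σ, m ∣ k := by
  by_cases hx : σ x = x
  · refine ⟨1, ?_, one_dvd k⟩
    rw [← Multiset.count_pos, count_one_fullCycleType]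
    exact Fintype.card_pos_iff.mpr ⟨⟨x, hx⟩⟩
  · have hc := Perm.isCycle_cycleOf σ hx
    refine ⟨(σ.cycleOf x).support.card, Multiset.mem_add.mpr (Or.inl ?_), ?_⟩
    · rw [Perm.cycleType_def, Multiset.mem_map]
      exact ⟨σ.cycleOf x, Perm.cycleOf_mem_cycleFactorsFinset_iff.mpr
        (Perm.mem_support.mpr hx), rfl⟩
    · rw [← hc.orderOf, orderOf_dvd_iff_pow_eq_one]
      refine (hc.pow_eq_one_iff' (x := x) ?_).mpr ?_
      · rwa [Perm.cycleOf_apply_self]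
      · rw [Perm.cycleOf_pow_apply_self, h]

end CycleType

/-! ### The translation subgroup of the triangle group `(2, 3, 6)` -/

section TriangleGroup

variable {G : Type*} [Group G] {X Y : G}

theorem triangle_mul_inv (hX : X ^ 2 = 1) :
    (X * Y * X * Y⁻¹) * (X * Y⁻¹ * X * Y)⁻¹ = X * Y * X * (Y⁻¹) ^ 2 * X * Y * X := by
  have hX' : X⁻¹ = X := inv_eq_of_mul_eq_one_right (by rw [← sq, hX])
  simp only [mul_inv_rev, inv_inv, hX', sq, mul_assoc]

theorem triangle_mul_inv_eq (hX : X ^ 2 = 1) (hY : Y ^ 3 = 1) :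
    (X * Y * X * Y⁻¹) * (X * Y⁻¹ * X * Y)⁻¹ = (X * Y) ^ 3 * X := by
  have hY' : (Y⁻¹) ^ 2 = Y := by
    rw [inv_pow]; exact inv_eq_of_mul_eq_one_right (by rw [← pow_succ, hY])
  rw [triangle_mul_inv hX, hY']
  simp only [pow_succ, pow_zero, one_mul, mul_assoc]

theorem triangle_inv_mul (hX : X ^ 2 = 1) (hY : Y ^ 3 = 1) :
    (X * Y⁻¹ * X * Y)⁻¹ * (X * Y * X * Y⁻¹) = Y⁻¹ * X * Y⁻¹ * X * Y⁻¹ := by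
  have hX' : X⁻¹ = X := inv_eq_of_mul_eq_one_right (by rw [← sq, hX])
  have hX2 : ∀ g, X * (X * g) = g := fun g => by rw [← mul_assoc, ← sq, hX, one_mul]
  have hY' : Y⁻¹ = Y * Y := inv_eq_of_mul_eq_one_right (by rw [← hY, pow_succ, sq, mul_assoc])
  have hY3 : ∀ g, Y * (Y * g) = Y⁻¹ * g := fun g => by rw [hY', mul_assoc]
  simp only [mul_inv_rev, inv_inv, hX', mul_assoc, hX2, hY3]

theorem triangle_commute (hX : X ^ 2 = 1) (hY : Y ^ 3 = 1) (hXY : (X * Y) ^ 6 = 1) :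
    Commute (X * Y * X * Y⁻¹) (X * Y⁻¹ * X * Y) := by
  have hX' : X⁻¹ = X := inv_eq_of_mul_eq_one_right (by rw [← sq, hX])
  have key : (X * Y) ^ 3 * X = Y⁻¹ * X * Y⁻¹ * X * Y⁻¹ := by
    have h : (X * Y) ^ 3 * X * (Y⁻¹ * X⁻¹ * Y⁻¹ * X⁻¹ * Y⁻¹)⁻¹ = 1 := by
      rw [← hXY]
      simp only [mul_inv_rev, inv_inv, pow_succ, pow_zero, one_mul, mul_assoc]
    rw [mul_inv_eq_one.mp h, hX']
  rw [← Commute.inv_right_iff]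
  exact (triangle_mul_inv_eq hX hY).trans (key.trans (triangle_inv_mul hX hY).symm)

theorem triangle_semiconj_left (hX : X ^ 2 = 1) (i j : ℤ) :
    X * ((X * Y * X * Y⁻¹) ^ i * (X * Y⁻¹ * X * Y) ^ j) =
      (X * Y * X * Y⁻¹) ^ (-i) * (X * Y⁻¹ * X * Y) ^ (-j) * X := by
  have hX' : X⁻¹ = X := inv_eq_of_mul_eq_one_right (by rw [← sq, hX])
  have ha : SemiconjBy X (X * Y * X * Y⁻¹) (X * Y * X * Y⁻¹)⁻¹ := by
    simp only [SemiconjBy, mul_inv_rev, inv_inv, hX', mul_assoc]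
    simp only [← sq, hX, mul_one, ← mul_assoc, one_mul]
  have hb : SemiconjBy X (X * Y⁻¹ * X * Y) (X * Y⁻¹ * X * Y)⁻¹ := by
    simp only [SemiconjBy, mul_inv_rev, inv_inv, hX', mul_assoc]
    simp only [← sq, hX, mul_one, ← mul_assoc, one_mul]
  have h := ((ha.zpow_right i).mul_right (hb.zpow_right j)).eq
  rwa [inv_zpow', inv_zpow'] at h

theorem triangle_semiconj_right (hX : X ^ 2 = 1) (hY : Y ^ 3 = 1) (hXY : (X * Y) ^ 6 = 1)
    (i j : ℤ) :
    Y * ((X * Y * X * Y⁻¹) ^ i * (X * Y⁻¹ * X * Y) ^ j) =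
      (X * Y * X * Y⁻¹) ^ (-i - j) * (X * Y⁻¹ * X * Y) ^ i * Y := by
  have hX' : X⁻¹ = X := inv_eq_of_mul_eq_one_right (by rw [← sq, hX])
  have hc := triangle_commute hX hY hXY
  have h1 := triangle_inv_mul hX hY
  have hb : SemiconjBy Y (X * Y⁻¹ * X * Y) (X * Y * X * Y⁻¹)⁻¹ := by
    simp only [SemiconjBy, mul_inv_rev, inv_inv, hX', mul_assoc]
  have ha : SemiconjBy Y (X * Y * X * Y⁻¹) ((X * Y * X * Y⁻¹)⁻¹ * (X * Y⁻¹ * X * Y)) := by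
    have h2 : (X * Y * X * Y⁻¹)⁻¹ * (X * Y⁻¹ * X * Y) = Y * X * Y * X * Y := by
      rw [← inv_inj, mul_inv_rev, inv_inv, h1]
      simp only [mul_inv_rev, hX', mul_assoc]
    have hY' : Y * Y = Y⁻¹ := (inv_eq_of_mul_eq_one_right (by rw [← hY, pow_succ, sq, mul_assoc])).symm
    rw [SemiconjBy, h2]
    simp only [mul_assoc, hY']
  generalize X * Y * X * Y⁻¹ = a at *
  generalize X * Y⁻¹ * X * Y = b at *
  have h := ((ha.zpow_right i).mul_right (hb.zpow_right j)).eq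
  rw [h, (hc.inv_left).mul_zpow, inv_zpow', inv_zpow', mul_assoc (a ^ (-i)),
    ((hc.symm.zpow_zpow i (-j)).eq), ← mul_assoc (a ^ (-i)), ← zpow_add, sub_eq_add_neg]

end TriangleGroup

/-- In an action of the triangle group `(2, 3, 6)`, a translation in the orbit of a point `p`
agreeing with the half-turn `X` at `p` forces a half-turn around an edge midpoint or a vertex
to have a fixed point. -/
theorem exists_fixed_halfTurn {α : Type*} {X Y : Perm α} (hX : X ^ 2 = 1) (hY : Y ^ 3 = 1)
    (hXY : (X * Y) ^ 6 = 1) {p : α} {i j : ℤ}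
    (hp : X p = ((X * Y * X * Y⁻¹) ^ i * (X * Y⁻¹ * X * Y) ^ j) p) :
    (∃ q, X q = q) ∨ ∃ q, ((X * Y) ^ 3) q = q := by
  have hXX : ∀ q, X (X q) = q := fun q => by rw [← Perm.mul_apply, ← sq, hX, Perm.one_apply]
  have hc := triangle_commute hX hY hXY
  have hab := triangle_mul_inv_eq hX hY
  have hs := triangle_semiconj_left (Y := Y) hX
  obtain ⟨a, ha⟩ : ∃ a, a = X * Y * X * Y⁻¹ := ⟨_, rfl⟩
  obtain ⟨b, hb⟩ : ∃ b, b = X * Y⁻¹ * X * Y := ⟨_, rfl⟩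
  rw [← ha, ← hb] at hp hc hab
  simp only [← ha, ← hb] at hs
  have hshift : ∀ u v : ℤ, X ((a ^ u * b ^ v) p) =
      (a ^ (i - 2 * u) * b ^ (j - 2 * v)) ((a ^ u * b ^ v) p) := by
    intro u v
    rw [← Perm.mul_apply, hs, Perm.mul_apply, hp, ← Perm.mul_apply, ← Perm.mul_apply]
    have hmul : ∀ r s t w : ℤ, a ^ r * b ^ s * (a ^ t * b ^ w) = a ^ (r + t) * b ^ (s + w) := by
      intro r s t w
      rw [mul_assoc, ← mul_assoc (b ^ s), (hc.symm.zpow_zpow s t).eq, zpow_add, zpow_add]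
      simp only [mul_assoc]
    rw [hmul, hmul]
    rw [show i - 2 * u + u = -u + i by ring, show j - 2 * v + v = -v + j by ring]
  have hconj : ∀ (W : Perm α) q, X q = (X * W * X * W⁻¹) q → X (W⁻¹ q) = W⁻¹ q := by
    intro W q h
    simp only [Perm.mul_apply] at h
    exact Perm.eq_inv_iff_eq.mpr (X.injective h).symm
  rcases Int.even_or_odd' i with ⟨u, rfl | rfl⟩ <;> rcases Int.even_or_odd' j with ⟨v, rfl | rfl⟩
  · have h := hshift u v
    simp only [sub_self, zpow_zero, one_mul, Perm.one_apply] at h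
    exact Or.inl ⟨_, h⟩
  · have h := hshift u v
    simp only [sub_self, zpow_zero, one_mul, add_sub_cancel_left, zpow_one] at h
    generalize (a ^ u * b ^ v) p = q at h
    refine Or.inl ⟨_, hconj Y⁻¹ q ?_⟩
    rw [h, hb, inv_inv]
  · have h := hshift u v
    simp only [sub_self, zpow_zero, mul_one, add_sub_cancel_left, zpow_one] at h
    generalize (a ^ u * b ^ v) p = q at h
    refine Or.inl ⟨_, hconj Y q ?_⟩
    rw [h, ha]
  · have h := hshift u (v + 1)
    rw [show 2 * u + 1 - 2 * u = 1 by ring, show 2 * v + 1 - 2 * (v + 1) = -1 by ring,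
      zpow_one, zpow_neg_one, hab] at h
    exact Or.inr ⟨_, h.symm⟩

/-- The half-turns about edge midpoints and vertices cannot both be fixed-point free in a
transitive action of the triangle group `(2, 3, 6)` of degree `1` modulo `3` in which `Y` has
exactly one fixed point. -/
theorem exists_fixed_halfTurn_of_transitive {α : Type*} [Fintype α]
    {X Y : Perm α} (hX : X ^ 2 = 1) (hY : Y ^ 3 = 1) (hXY : (X * Y) ^ 6 = 1) {p : α}
    (hp : Y p = p) (huniq : ∀ q, Y q = q → q = p) (hcard : Fintype.card α % 3 = 1)
    (htrans : ∀ S : Set α, p ∈ S → (∀ q ∈ S, X q ∈ S) → (∀ q ∈ S, Y q ∈ S) → S = Set.univ) :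
    (∃ q, X q = q) ∨ ∃ q, ((X * Y) ^ 3) q = q := by
  classical
  have hXX : ∀ q, X (X q) = q := fun q => by rw [← Perm.mul_apply, ← sq, hX, Perm.one_apply]
  have hs := triangle_semiconj_left (Y := Y) hX
  have ht := triangle_semiconj_right hX hY hXY
  have hc := triangle_commute hX hY hXY
  have hfix := @exists_fixed_halfTurn α X Y hX hY hXY p
  have hYX : Y * X = (X * Y * X * Y⁻¹) ^ (-1 : ℤ) * (X * Y) := by
    have hX' : X⁻¹ = X := inv_eq_of_mul_eq_one_right (by rw [← sq, hX])
    rw [zpow_neg_one]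
    simp only [mul_inv_rev, inv_inv, hX', mul_assoc]
    rw [← mul_assoc X X, ← sq, hX, one_mul, inv_mul_cancel, mul_one]
  generalize X * Y * X * Y⁻¹ = a at *
  generalize X * Y⁻¹ * X * Y = b at *
  have hmul : ∀ r s t w : ℤ, a ^ r * b ^ s * (a ^ t * b ^ w) = a ^ (r + t) * b ^ (s + w) := by
    intro r s t w
    rw [mul_assoc, ← mul_assoc (b ^ s), (hc.symm.zpow_zpow s t).eq, zpow_add, zpow_add]
    simp only [mul_assoc]
  let O : Set α := {q | ∃ i j : ℤ, q = (a ^ i * b ^ j) p}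
  have hYO : ∀ q ∈ O, Y q ∈ O := by
    rintro _ ⟨i, j, rfl⟩
    refine ⟨-i - j, i, ?_⟩
    rw [← Perm.mul_apply, ht, Perm.mul_apply, hp]
  have htransO : ∀ q ∈ O, ∀ i j : ℤ, (a ^ i * b ^ j) q ∈ O := by
    rintro _ ⟨k, l, rfl⟩ i j
    exact ⟨i + k, j + l, by rw [← Perm.mul_apply, hmul]⟩
  have hYXO : ∀ q, X q ∈ O → X (Y q) ∈ O := by
    intro q hq
    have h1 : X (Y q) = a (Y (X q)) := by
      rw [← Perm.mul_apply Y X, hYX, zpow_neg_one, ← Perm.mul_apply, ← Perm.mul_apply,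
        mul_inv_cancel_left, Perm.mul_apply]
    rw [h1]
    simpa using htransO _ (hYO _ hq) 1 0
  have hpO : p ∈ O := ⟨0, 0, by simp⟩
  have hcover : O ∪ X ⁻¹' O = Set.univ := by
    refine htrans _ (Or.inl hpO) ?_ ?_
    · rintro q (hq | hq)
      · exact Or.inr (by rwa [Set.mem_preimage, hXX])
      · exact Or.inl hq
    · rintro q (hq | hq)
      · exact Or.inl (hYO q hq)
      · exact Or.inr (hYXO q hq)
  by_cases hdisj : Disjoint O (X ⁻¹' O)
  · exfalso
    have hsum : Fintype.card α = 2 * O.ncard := by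
      rw [← Nat.card_eq_fintype_card, ← Set.ncard_univ, ← hcover, Set.ncard_union_eq hdisj,
        Set.ncard_preimage_of_injective_subset_range X.injective (by simp), two_mul]
    have hO : O.ncard ≡ 1 [MOD 3] := by
      let f : Function.End O := fun q => ⟨Y q, hYO q q.2⟩
      have hf : f ^ 3 ^ 1 = 1 := by
        funext q
        apply Subtype.ext
        change Y (Y (Y q)) = q
        rw [← Perm.mul_apply, ← Perm.mul_apply, show Y * Y * Y = Y ^ 3 by rw [pow_succ, sq], hY,
          Perm.one_apply]
      have : Fact (Nat.Prime 3) := ⟨Nat.prime_three⟩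
      have h := Equiv.Perm.card_fixedPoints_modEq hf
      have h1 : Fintype.card f.fixedPoints = 1 := by
        refine Fintype.card_eq_one_iff.mpr ⟨⟨⟨p, hpO⟩, Subtype.ext hp⟩, ?_⟩
        rintro ⟨⟨q, hq⟩, hfq⟩
        exact Subtype.ext (Subtype.ext (huniq q (congrArg Subtype.val hfq)))
      rw [h1, ← Nat.card_eq_fintype_card, Nat.card_coe_set_eq] at h
      exact h
    unfold Nat.ModEq at hO
    omega
  · obtain ⟨q, ⟨i, j, rfl⟩, ⟨k, l, hkl⟩⟩ := Set.not_disjoint_iff.mp hdisj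
    refine hfix (i := i + k) (j := j + l) ?_
    have h : X ((a ^ i * b ^ j) p) = (a ^ (-i) * b ^ (-j)) (X p) := by
      rw [← Perm.mul_apply, hs, Perm.mul_apply]
    rw [← hmul, Perm.mul_apply, ← hkl, h, ← Perm.mul_apply, hmul]
    simp

/-- The genus-0 ramification type [2^*][1,3^*][2,2,6^*] is not realizable in any degree. -/
theorem stmt10 (n : ℕ) (hn : 4 ≤ n) (hmod : n % 6 = 4) :
    ¬ Realizable n
      [Multiset.replicate (n / 2) 2,
        1 ::ₘ Multiset.replicate ((n - 1) / 3) 3,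
        2 ::ₘ 2 ::ₘ Multiset.replicate ((n - 4) / 6) 6] := by
  rintro ⟨σ, hσ, hprod, htrans⟩
  obtain ⟨X, σ, rfl, hXt, hσ⟩ := List.map_eq_cons_iff.mp hσ
  obtain ⟨Y, σ, rfl, hYt, hσ⟩ := List.map_eq_cons_iff.mp hσ
  obtain ⟨Z, σ, rfl, hZt, hσ⟩ := List.map_eq_cons_iff.mp hσ
  obtain rfl := List.map_eq_nil_iff.mp hσ
  have hZ : Z = (X * Y)⁻¹ := by
    simp only [List.prod_cons, List.prod_nil, mul_one] at hprod
    exact eq_inv_of_mul_eq_one_right (by rw [mul_assoc, hprod])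
  have hX2 : X ^ 2 = 1 := by
    apply pow_eq_one_of_forall_mem_fullCycleType
    intro m hm
    rw [hXt] at hm
    rw [Multiset.eq_of_mem_replicate hm]
  have hY3 : Y ^ 3 = 1 := by
    apply pow_eq_one_of_forall_mem_fullCycleType
    intro m hm
    rw [hYt, Multiset.mem_cons] at hm
    rcases hm with rfl | hm
    · norm_num
    · rw [Multiset.eq_of_mem_replicate hm]
  have hZ6 : Z ^ 6 = 1 := by
    apply pow_eq_one_of_forall_mem_fullCycleType
    intro m hm
    rw [hZt, Multiset.mem_cons, Multiset.mem_cons] at hm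
    rcases hm with rfl | rfl | hm
    · norm_num
    · norm_num
    · rw [Multiset.eq_of_mem_replicate hm]
  have hXY : (X * Y) ^ 6 = 1 := by rwa [hZ, inv_pow, inv_eq_one] at hZ6
  have hfixY : Fintype.card (fixedPoints Y) = 1 := by
    rw [← count_one_fullCycleType, hYt, Multiset.count_cons_self, Multiset.count_replicate]
    norm_num
  obtain ⟨⟨p, hp⟩, huniq⟩ := Fintype.card_eq_one_iff.mp hfixY
  have key := exists_fixed_halfTurn_of_transitive hX2 hY3 hXY hp
    (fun q hq => congrArg Subtype.val (huniq ⟨q, hq⟩)) (by rw [Fintype.card_fin]; omega) ?_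
  · rcases key with ⟨q, hq⟩ | ⟨q, hq⟩
    · obtain ⟨m, hm, hdvd⟩ := exists_mem_fullCycleType_dvd (σ := X) (k := 1) (x := q)
        (by rwa [pow_one])
      rw [hXt] at hm
      rw [Multiset.eq_of_mem_replicate hm] at hdvd
      norm_num at hdvd
    · obtain ⟨m, hm, hdvd⟩ := exists_mem_fullCycleType_dvd (σ := Z) (k := 3) (x := q)
        (by rw [hZ, inv_pow]; exact Perm.inv_eq_iff_eq.mpr hq.symm)
      rw [hZt, Multiset.mem_cons, Multiset.mem_cons] at hm
      rcases hm with rfl | rfl | hm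
      · norm_num at hdvd
      · norm_num at hdvd
      · rw [Multiset.eq_of_mem_replicate hm] at hdvd
        norm_num at hdvd
  · intro S hpS hXS hYS
    have hmem : ∀ g ∈ Subgroup.closure {g | g ∈ [X, Y, Z]}, ∀ q, g q ∈ S ↔ q ∈ S := by
      have hXm : ∀ q, X q ∈ S ↔ q ∈ S := fun q => by
        refine ⟨fun h => ?_, hXS q⟩
        have h' := hXS _ h
        rwa [← Perm.mul_apply, ← sq, hX2] at h'
      have hYm : ∀ q, Y q ∈ S ↔ q ∈ S := fun q => by
        refine ⟨fun h => ?_, hYS q⟩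
        have h' := hYS _ (hYS _ h)
        rwa [← Perm.mul_apply, ← Perm.mul_apply, ← pow_three', hY3] at h'
      intro g hg
      induction hg using Subgroup.closure_induction with
      | mem g hg =>
        simp only [Set.mem_ofPred_eq, List.mem_cons, List.not_mem_nil, or_false] at hg
        rcases hg with rfl | rfl | rfl
        · exact hXm
        · exact hYm
        · intro q
          rw [hZ, ← hYm, ← hXm, ← Perm.mul_apply, ← Perm.mul_apply, mul_inv_cancel,
            Perm.one_apply]
      | one => exact fun q => Iff.rfl
      | mul g h _ _ hg hh => exact fun q => (hg _).trans (hh q)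
      | inv g _ hg =>
        intro q
        rw [← hg, ← Perm.mul_apply, mul_inv_cancel, Perm.one_apply]
    refine Set.eq_univ_of_forall fun q => ?_
    obtain ⟨g, hg, rfl⟩ := htrans p q
    exact (hmem g hg p).mpr hpS
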